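/- Backward-Equivalent Conflict Preservation: Let N be an NFA with vertex type V, let L0 be a backward-admissible partition of V, and let ∼ be an equivalence relation on V that refines backward-equivalence with respect to L0 (v ∼ w implies v ∼bwd(L0) w) and such that every ∼-equivalence class is contained in some member of L0. Then the grouped NFA N/∼ has a conflict if and only if N has a conflict. -/

import Mathlib

/-- An NFA with accepting actions: vertices `V`, alphabet `A` (edge labels in
`Option A`, with `none` the ε-label), accepting actions `T` with a conflict
relation, starting vertex, edge relation, and accepting-action assignment. -/
structure NFAA (V A T : Type*) where
  start : V
  edge : V → Option A → V → Prop
  conf : T → T → Prop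
  act : V → Set T

variable {V A T : Type*}

/-- `w` is reachable from `v` on the sequence `τ`. -/
def NFAA.ReachFrom (N : NFAA V A T) : V → List (Option A) → V → Prop
  | v, [], w => v = w
  | v, σ :: τ, w => ∃ u : V, N.edge v σ u ∧ N.ReachFrom u τ w

/-- `w` is reachable (from the starting vertex) on the sequence `τ`. -/
def NFAA.Reach (N : NFAA V A T) (τ : List (Option A)) (w : V) : Prop :=
  N.ReachFrom N.start τ w

/-- A conflict: two sequences with equal strings, reaching vertices carrying
conflicting actions. -/
def NFAA.HasConflict (N : NFAA V A T) : Prop :=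
  ∃ τ τ' : List (Option A), ∃ w w' : V, ∃ a a' : T,
    τ.filterMap id = τ'.filterMap id ∧
    N.Reach τ w ∧ N.Reach τ' w' ∧
    a ∈ N.act w ∧ a' ∈ N.act w' ∧ N.conf a a'

/-- The grouped NFA `N/∼` for an equivalence relation (setoid) `s` on `V`. -/
def NFAA.group (N : NFAA V A T) (s : Setoid V) : NFAA (Quotient s) A T where
  start := Quotient.mk s N.start
  edge c σ d := ∃ v w : V, Quotient.mk s v = c ∧ Quotient.mk s w = d ∧ N.edge v σ w
  conf := N.conf
  act c := {a : T | ∃ v : V, Quotient.mk s v = c ∧ a ∈ N.act v}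

/-- Forward equivalence: reachable from the start on exactly the same sequences. -/
def NFAA.FwdEquiv (N : NFAA V A T) (v₁ v₂ : V) : Prop :=
  ∀ τ : List (Option A), N.Reach τ v₁ ↔ N.Reach τ v₂

/-- Backward equivalence with respect to an initial partition `L0`. -/
def NFAA.BwdEquiv (N : NFAA V A T) (L0 : Set (Set V)) (v₁ v₂ : V) : Prop :=
  ∀ Z ∈ L0, ∀ τ : List (Option A),
    (∃ w ∈ Z, N.ReachFrom v₁ τ w) ↔ (∃ w ∈ Z, N.ReachFrom v₂ τ w)

/-- A partition of `V`: pairwise disjoint nonempty subsets whose union is `V`. -/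
def IsPartitionOf (L : Set (Set V)) : Prop :=
  (∀ Z ∈ L, Z.Nonempty) ∧
  (∀ Z ∈ L, ∀ Z' ∈ L, Z ≠ Z' → Z ∩ Z' = ∅) ∧
  ⋃₀ L = Set.univ

/-- `L` refines `L0`: every member of `L` is contained in some member of `L0`. -/
def RefinesPartition (L L0 : Set (Set V)) : Prop :=
  ∀ Y ∈ L, ∃ Z ∈ L0, Y ⊆ Z

/-- The forward image `Z[σ]`. -/
def NFAA.fwdImg (N : NFAA V A T) (Z : Set V) (σ : Option A) : Set V :=
  {w : V | ∃ z ∈ Z, N.edge z σ w}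

/-- The backward image `Z⁻[σ]`. -/
def NFAA.bwdImg (N : NFAA V A T) (Z : Set V) (σ : Option A) : Set V :=
  {z : V | ∃ w ∈ Z, N.edge z σ w}

/-- `L` is forward-stable. -/
def NFAA.FwdStable (N : NFAA V A T) (L : Set (Set V)) : Prop :=
  ∀ Z ∈ L, ∀ σ : Option A, ∀ Y ∈ L,
    Y ⊆ N.fwdImg Z σ ∨ Y ∩ N.fwdImg Z σ = ∅

/-- `L` is backward-stable. -/
def NFAA.BwdStable (N : NFAA V A T) (L : Set (Set V)) : Prop :=
  ∀ Z ∈ L, ∀ σ : Option A, ∀ Y ∈ L,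
    Y ⊆ N.bwdImg Z σ ∨ Y ∩ N.bwdImg Z σ = ∅

/-- `L0` is backward-admissible. -/
def NFAA.BwdAdmissible (N : NFAA V A T) (L0 : Set (Set V)) : Prop :=
  ∀ Z ∈ L0, ∀ Z' ∈ L0,
    (∃ w₁ ∈ Z, ∃ w₂ ∈ Z', ∃ a ∈ N.act w₁, ∃ a' ∈ N.act w₂, N.conf a a') →
    ∀ v₁ ∈ Z, ∀ v₂ ∈ Z', ∃ a ∈ N.act v₁, ∃ a' ∈ N.act v₂, N.conf a a'

/-- Reachability in `N` projects to the grouped NFA. -/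
theorem NFAA.ReachFrom.group (N : NFAA V A T) (s : Setoid V) {τ : List (Option A)} {v w : V}
    (h : N.ReachFrom v τ w) :
    (N.group s).ReachFrom (Quotient.mk s v) τ (Quotient.mk s w) := by
  induction τ generalizing v with
  | nil => exact congrArg (Quotient.mk s) h
  | cons σ τ ih =>
    obtain ⟨u, hu, hr⟩ := h
    exact ⟨Quotient.mk s u, ⟨v, u, rfl, rfl, hu⟩, ih hr⟩

/-- If `s` refines backward equivalence, reaching the class of an element of `Z ∈ L0` in the
grouped NFA implies reaching some element of `Z` in `N`. -/
theorem NFAA.exists_reachFrom_of_group (N : NFAA V A T) {L0 : Set (Set V)} {s : Setoid V}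
    (hrefine : ∀ v w : V, s.r v w → N.BwdEquiv L0 v w) {Z : Set V} (hZ : Z ∈ L0)
    {τ : List (Option A)} {v w : V} (hw : w ∈ Z)
    (h : (N.group s).ReachFrom (Quotient.mk s v) τ (Quotient.mk s w)) :
    ∃ w' ∈ Z, N.ReachFrom v τ w' := by
  induction τ generalizing v with
  | nil => exact (hrefine v w (Quotient.exact h) Z hZ []).2 ⟨w, hw, rfl⟩
  | cons σ τ ih =>
    obtain ⟨_, ⟨v', u, hv, rfl, hu⟩, hr⟩ := h
    obtain ⟨w', hw', hr'⟩ := ih hr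
    exact (hrefine v' v (Quotient.exact hv) Z hZ (σ :: τ)).1 ⟨w', hw', u, hu, hr'⟩

/-- **Backward-Equivalent Conflict Preservation.** If `L0` is a
backward-admissible partition, `s` refines backward-equivalence w.r.t. `L0`,
and every `s`-class is contained in some member of `L0`, then the grouped NFA
has a conflict iff the original NFA has a conflict. -/
theorem bwd_equiv_conflict_preservation (N : NFAA V A T)
    (L0 : Set (Set V)) (hpart : IsPartitionOf L0)
    (hadm : N.BwdAdmissible L0) (s : Setoid V)
    (hrefine : ∀ v w : V, s.r v w → N.BwdEquiv L0 v w)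
    (hclass : ∀ v : V, ∃ Z ∈ L0, ∀ w : V, s.r v w → w ∈ Z) :
    (N.group s).HasConflict ↔ N.HasConflict := by
  constructor
  · rintro ⟨τ, τ', _, _, a, a', hτ, hr, hr', ⟨v, rfl, ha⟩, ⟨v', rfl, ha'⟩, hc⟩
    obtain ⟨Z, hZ, hvZ⟩ := hclass v
    obtain ⟨Z', hZ', hvZ'⟩ := hclass v'
    have hv := hvZ v (s.refl v)
    have hv' := hvZ' v' (s.refl v')
    obtain ⟨w, hw, hNw⟩ := N.exists_reachFrom_of_group hrefine hZ hv hr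
    obtain ⟨w', hw', hNw'⟩ := N.exists_reachFrom_of_group hrefine hZ' hv' hr'
    obtain ⟨b, hb, b', hb', hbc⟩ :=
      hadm Z hZ Z' hZ' ⟨v, hv, v', hv', a, ha, a', ha', hc⟩ w hw w' hw'
    exact ⟨τ, τ', w, w', b, b', hτ, hNw, hNw', hb, hb', hbc⟩
  · rintro ⟨τ, τ', w, w', a, a', hτ, hr, hr', ha, ha', hc⟩
    exact ⟨τ, τ', Quotient.mk s w, Quotient.mk s w', a, a', hτ, hr.group N s, hr'.group N s,
      ⟨w, rfl, ha⟩, ⟨w', rfl, ha'⟩, hc⟩
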